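/- Let G be the graph on the 246 vertices {u_i, x_i, y_i, z_i, w_i, v_i : i ∈ Z₄₁} whose edge set is the union of the 41-cycle u₀u₁⋯u₄₀u₀, the 41-cycle v₀v₇v₁₄⋯v₃₄v₀ (edges v_i v_{i+7}, indices mod 41), and the paths u_i x_i y_i z_i w_i v_i for i ∈ Z₄₁. For i ∈ Z₄₁ let T_i be the subgraph of G induced on the 36 vertices u_i, u_{i+1}, …, u_{i+5}; v_i, v_{i+7}, v_{i+14}, v_{i+21}, v_{i+28}, v_{i+35}; x_i, y_i, z_i, w_i; x_{i+2}, y_{i+2}, z_{i+2}, w_{i+2}; x_{i+3}, y_{i+3}, z_{i+3}; x_{i+4}, y_{i+4}; x_{i+5}; w_{i+14}; w_{i+21}, z_{i+21}; w_{i+28}, z_{i+28}, y_{i+28}; w_{i+35}, z_{i+35}, y_{i+35}, x_{i+35} (indices mod 41). Then: each T_i is a tree on 36 vertices; any two of the T_i have a common vertex; each vertex of G lies in exactly 6 of the T_i; and two distinct vertices of G lie together in exactly 5 of the T_i if and only if they are adjacent in G. -/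

import Mathlib

/-- The 246 vertices of the graph `G`: `u_i, x_i, y_i, z_i, w_i, v_i`, `i ∈ Z₄₁`. -/
def u (i : ZMod 41) : Fin 6 × ZMod 41 := (0, i)
def x (i : ZMod 41) : Fin 6 × ZMod 41 := (1, i)
def y (i : ZMod 41) : Fin 6 × ZMod 41 := (2, i)
def z (i : ZMod 41) : Fin 6 × ZMod 41 := (3, i)
def w (i : ZMod 41) : Fin 6 × ZMod 41 := (4, i)
def v (i : ZMod 41) : Fin 6 × ZMod 41 := (5, i)

/-- The edges of `G` : the `41`-cycle `u₀u₁⋯u₄₀u₀`, the `41`-cycle `v₀v₇v₁₄⋯v₃₄v₀`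
(edges `v_i v_{i+7}`), and the paths `u_i x_i y_i z_i w_i v_i`, `i ∈ Z₄₁`. -/
def G41 : SimpleGraph (Fin 6 × ZMod 41) :=
  SimpleGraph.fromRel fun p q =>
    (∃ i, p = u i ∧ q = u (i + 1)) ∨ (∃ i, p = v i ∧ q = v (i + 7)) ∨
    (∃ i, p = u i ∧ q = x i) ∨ (∃ i, p = x i ∧ q = y i) ∨
    (∃ i, p = y i ∧ q = z i) ∨ (∃ i, p = z i ∧ q = w i) ∨
    (∃ i, p = w i ∧ q = v i)

/-- The 36-element vertex set of the induced subtree `T_i`, `i ∈ Z₄₁`. -/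
def T (i : ZMod 41) : Finset (Fin 6 × ZMod 41) :=
  { u i, u (i + 1), u (i + 2), u (i + 3), u (i + 4), u (i + 5),
    v i, v (i + 7), v (i + 14), v (i + 21), v (i + 28), v (i + 35),
    x i, y i, z i, w i,
    x (i + 2), y (i + 2), z (i + 2), w (i + 2),
    x (i + 3), y (i + 3), z (i + 3),
    x (i + 4), y (i + 4),
    x (i + 5),
    w (i + 14),
    w (i + 21), z (i + 21),
    w (i + 28), z (i + 28), y (i + 28),
    w (i + 35), z (i + 35), y (i + 35), x (i + 35) }

def L41 : List (Fin 6 × ZMod 41) :=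
  [(0,0),(0,1),(0,2),(0,3),(0,4),(0,5),
   (5,0),(5,7),(5,14),(5,21),(5,28),(5,35),
   (1,0),(2,0),(3,0),(4,0),
   (1,2),(2,2),(3,2),(4,2),
   (1,3),(2,3),(3,3),
   (1,4),(2,4),
   (1,5),
   (4,14),
   (4,21),(3,21),
   (4,28),(3,28),(2,28),
   (4,35),(3,35),(2,35),(1,35)]

def M41 (k : Fin 6) : List ℕ :=
  match k with
  | 0 => [0,1,2,3,4,5]
  | 1 => [0,2,3,4,5,35]
  | 2 => [0,2,3,4,28,35]
  | 3 => [0,2,3,21,28,35]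
  | 4 => [0,2,14,21,28,35]
  | 5 => [0,7,14,21,28,35]

def B41 (k : Fin 6) (n : ℕ) : Bool := (M41 k).any (fun m => Nat.beq m n)

def R41 (k l : Fin 6) (n : ℕ) : Bool :=
  (k.val == 0 && l.val == 0 && (n == 1 || n == 40)) ||
  (k.val == 5 && l.val == 5 && (n == 7 || n == 34)) ||
  (n == 0 && (k.val + 1 == l.val || l.val + 1 == k.val))

theorem T_eq (i : ZMod 41) : T i = (L41.map fun p => (p.1, i + p.2)).toFinset := by
  simp [T, L41, u, v, x, y, z, w]

theorem mem_L (k : Fin 6) (d : ZMod 41) : (k, d) ∈ L41 ↔ B41 k d.val = true := by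
  revert k d; decide +kernel

theorem mem_T (k : Fin 6) (a i : ZMod 41) : (k, a) ∈ T i ↔ B41 k (a - i).val = true := by
  rw [← mem_L, T_eq]
  simp only [List.mem_toFinset, List.mem_map, Prod.mk.injEq]
  constructor
  · rintro ⟨p, hp, rfl, rfl⟩
    simpa using hp
  · intro h
    exact ⟨_, h, rfl, by simp⟩

set_option synthInstance.maxSize 4000 in
set_option synthInstance.maxHeartbeats 400000 in
theorem adj_aux (k l : Fin 6) (d : ZMod 41) : R41 k l d.val = true ↔
    (((k = 0 ∧ l = 0 ∧ d = 1) ∨ (k = 5 ∧ l = 5 ∧ d = 7) ∨ (k = 0 ∧ l = 1 ∧ d = 0) ∨ (k = 1 ∧ l = 2 ∧ d = 0) ∨ (k = 2 ∧ l = 3 ∧ d = 0) ∨ (k = 3 ∧ l = 4 ∧ d = 0) ∨ (k = 4 ∧ l = 5 ∧ d = 0)) ∨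
    ((l = 0 ∧ k = 0 ∧ d = -1) ∨ (l = 5 ∧ k = 5 ∧ d = -7) ∨ (l = 0 ∧ k = 1 ∧ d = 0) ∨ (l = 1 ∧ k = 2 ∧ d = 0) ∨ (l = 2 ∧ k = 3 ∧ d = 0) ∨ (l = 3 ∧ k = 4 ∧ d = 0) ∨ (l = 4 ∧ k = 5 ∧ d = 0))) := by
  revert k l d; decide +kernel

theorem adj_irr (k : Fin 6) : R41 k k (0 : ZMod 41).val = false := by
  revert k; decide +kernel

theorem adj_iff (k l : Fin 6) (a b : ZMod 41) :
    G41.Adj (k, a) (l, b) ↔ R41 k l (b - a).val = true := by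
  have key : (k, a) ≠ (l, b) ∨ R41 k l (b - a).val = false := by
    by_cases h : (k, a) = (l, b)
    · obtain ⟨rfl, rfl⟩ := Prod.mk.inj h
      right; rw [sub_self]; exact adj_irr k
    · exact Or.inl h
  have h2 : R41 k l (b - a).val = true ↔ (((∃ i, (k, a) = u i ∧ (l, b) = u (i + 1)) ∨ (∃ i, (k, a) = v i ∧ (l, b) = v (i + 7)) ∨
    (∃ i, (k, a) = u i ∧ (l, b) = x i) ∨ (∃ i, (k, a) = x i ∧ (l, b) = y i) ∨
    (∃ i, (k, a) = y i ∧ (l, b) = z i) ∨ (∃ i, (k, a) = z i ∧ (l, b) = w i) ∨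
    (∃ i, (k, a) = w i ∧ (l, b) = v i)) ∨ ((∃ i, (l, b) = u i ∧ (k, a) = u (i + 1)) ∨ (∃ i, (l, b) = v i ∧ (k, a) = v (i + 7)) ∨
    (∃ i, (l, b) = u i ∧ (k, a) = x i) ∨ (∃ i, (l, b) = x i ∧ (k, a) = y i) ∨
    (∃ i, (l, b) = y i ∧ (k, a) = z i) ∨ (∃ i, (l, b) = z i ∧ (k, a) = w i) ∨
    (∃ i, (l, b) = w i ∧ (k, a) = v i))) := by
    rw [adj_aux]
    have e1 : ∀ c : ZMod 41, b - a = c ↔ b = a + c := fun c => by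
      rw [sub_eq_iff_eq_add, add_comm]
    have e2 : ∀ c : ZMod 41, b - a = -c ↔ a = b + c := fun c => by
      constructor <;> intro h
      · linear_combination -h
      · linear_combination -h
    have e3 : b - a = 0 ↔ b = a := sub_eq_zero
    have g : ∀ (P Q : Prop) (c d : ZMod 41), (∃ i, (P ∧ c = i) ∧ (Q ∧ d = i)) ↔ P ∧ Q ∧ d = c := by
      intro P Q c d
      constructor
      · rintro ⟨i, ⟨hp, rfl⟩, hq, rfl⟩; exact ⟨hp, hq, rfl⟩
      · rintro ⟨hp, hq, rfl⟩; exact ⟨d, ⟨hp, rfl⟩, hq, rfl⟩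
    have g' : ∀ (P Q : Prop) (c d e : ZMod 41), (∃ i, (P ∧ c = i) ∧ (Q ∧ d = i + e)) ↔ P ∧ Q ∧ d = c + e := by
      intro P Q c d e
      constructor
      · rintro ⟨i, ⟨hp, rfl⟩, hq, rfl⟩; exact ⟨hp, hq, rfl⟩
      · rintro ⟨hp, hq, rfl⟩; exact ⟨c, ⟨hp, rfl⟩, hq, rfl⟩
    simp only [u, v, x, y, z, w, Prod.mk.injEq, g, g', e3, e1 1, e1 7, e2, eq_comm (a := a) (b := b)]
  rw [h2, G41, SimpleGraph.fromRel_adj, ← h2]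
  constructor
  · exact fun h => h.2
  · intro h
    refine ⟨?_, h⟩
    rcases key with hk | hk
    · exact hk
    · rw [h] at hk; cases hk

def P41 (j : Fin 36) : Fin 6 × ZMod 41 := L41.get j

def H41 : SimpleGraph (Fin 36) where
  Adj j j' := R41 (P41 j).1 (P41 j').1 ((P41 j').2 - (P41 j).2).val = true
  symm := ⟨by decide +kernel⟩
  loopless := ⟨by decide +kernel⟩

instance : DecidableRel H41.Adj := fun j j' =>
  inferInstanceAs (Decidable (R41 (P41 j).1 (P41 j').1 ((P41 j').2 - (P41 j).2).val = true))

def rk41 (j : Fin 36) : ℕ :=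
  let d := (P41 j).2.val
  let k := (P41 j).1.val
  if d ≤ 5 then 10 * k + d else 1000 + 10 * d - k

theorem H41_par : ∀ j : Fin 36, j ≠ 0 → ∃ j', rk41 j' < rk41 j ∧ H41.Adj j' j := by
  decide +kernel

theorem H41_deg : ∑ j, H41.degree j = 70 := by
  decide +kernel

theorem H41_reach (n : ℕ) : ∀ j, rk41 j = n → H41.Reachable 0 j := by
  induction n using Nat.strong_induction_on with
  | _ n ih =>
    intro j hj
    by_cases h0 : j = 0
    · subst h0; exact SimpleGraph.Reachable.refl _
    · obtain ⟨j', h1, h2⟩ := H41_par j h0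
      exact (ih _ (hj ▸ h1) j' rfl).trans h2.reachable

theorem H41_tree : H41.IsTree := by
  rw [SimpleGraph.isTree_iff_connected_and_card]
  constructor
  · have : Nonempty (Fin 36) := ⟨0⟩
    exact ⟨fun a b => (H41_reach _ a rfl).symm.trans (H41_reach _ b rfl)⟩
  · have h := H41.sum_degrees_eq_twice_card_edges
    rw [H41_deg] at h
    have h3 : H41.edgeFinset.card = 35 := by omega
    rw [Nat.card_eq_fintype_card, ← SimpleGraph.edgeFinset_card, h3]
    simp

theorem P41_inj : ∀ j j', P41 j = P41 j' → j = j' := by decide +kernel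

theorem mem_T' (i : ZMod 41) (p : Fin 6 × ZMod 41) :
    p ∈ T i ↔ ∃ j, ((P41 j).1, i + (P41 j).2) = p := by
  rw [T_eq]
  simp only [List.mem_toFinset, List.mem_map]
  constructor
  · rintro ⟨q, hq, rfl⟩
    obtain ⟨j, rfl⟩ := List.get_of_mem hq
    exact ⟨j, rfl⟩
  · rintro ⟨j, rfl⟩
    exact ⟨P41 j, List.get_mem _ _, rfl⟩

noncomputable def E41 (i : ZMod 41) : Fin 36 ≃ (T i : Set (Fin 6 × ZMod 41)) :=
  Equiv.ofBijective
    (fun j => ⟨((P41 j).1, i + (P41 j).2), (mem_T' i _).2 ⟨j, rfl⟩⟩)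
    ⟨fun j j' h => by
      have h' := Prod.mk.inj (Subtype.ext_iff.1 h)
      exact P41_inj _ _ (Prod.ext h'.1 (add_left_cancel h'.2)),
     fun q => by
      obtain ⟨j, hj⟩ := (mem_T' i q.1).1 q.2
      exact ⟨j, Subtype.ext hj⟩⟩

noncomputable def I41 (i : ZMod 41) : H41 ≃g G41.induce (T i : Set (Fin 6 × ZMod 41)) where
  toEquiv := E41 i
  map_rel_iff' := by
    intro j j'
    change G41.Adj ((P41 j).1, i + (P41 j).2) ((P41 j').1, i + (P41 j').2) ↔
      R41 (P41 j).1 (P41 j').1 ((P41 j').2 - (P41 j).2).val = true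
    rw [adj_iff, add_sub_add_left_eq_sub]

theorem meet_aux : ∀ d : ZMod 41, ∃ k : Fin 6, ∃ t : ZMod 41,
    B41 k t.val = true ∧ B41 k (t + d).val = true := by decide +kernel

theorem cnt1 : ∀ k : Fin 6, (Finset.univ.filter fun t : ZMod 41 => B41 k t.val = true).card = 6 := by
  decide +kernel

theorem cnt2 : ∀ k l : Fin 6, ∀ d : ZMod 41, (k ≠ l ∨ d ≠ 0) →
    ((Finset.univ.filter fun t : ZMod 41 => B41 k t.val = true ∧ B41 l (t + d).val = true).card = 5
      ↔ R41 k l d.val = true) := by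
  decide +kernel

/-- Each `T_i` is an induced subtree of `G` on 36 vertices; any two
of the `T_i` have a common vertex; each vertex of `G` lies in exactly 6 of the `T_i`;
and two distinct vertices of `G` lie together in exactly 5 of the `T_i` if and only if
they are adjacent in `G`. -/
theorem stmt14 :
    (∀ i : ZMod 41, (G41.induce (T i : Set (Fin 6 × ZMod 41))).IsTree ∧ (T i).card = 36) ∧
      (∀ i j : ZMod 41, ∃ p : Fin 6 × ZMod 41, p ∈ T i ∧ p ∈ T j) ∧
      (∀ p : Fin 6 × ZMod 41, ({i : ZMod 41 | p ∈ T i} : Finset (ZMod 41)).card = 6) ∧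
      (∀ p q : Fin 6 × ZMod 41, p ≠ q →
        ((({i : ZMod 41 | p ∈ T i ∧ q ∈ T i} : Finset (ZMod 41)).card = 5) ↔
          G41.Adj p q)) := by
  refine ⟨fun i => ⟨(I41 i).isTree_iff.1 H41_tree, ?_⟩, ?_, ?_, ?_⟩
  · have h := Nat.card_congr (E41 i)
    simpa using h.symm
  · intro i j
    obtain ⟨k, t, h1, h2⟩ := meet_aux (i - j)
    refine ⟨(k, i + t), (mem_T _ _ _).2 (by simpa using h1), (mem_T _ _ _).2 ?_⟩
    rwa [show i + t - j = t + (i - j) by ring]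
  · rintro ⟨k, a⟩
    refine Eq.trans ?_ (cnt1 k)
    refine Finset.card_bij (fun i _ => a - i) ?_ ?_ ?_
    · intro i hi
      simpa [mem_T] using hi
    · intro i _ j _ h
      exact sub_right_injective h
    · intro t ht
      refine ⟨a - t, ?_, by ring⟩
      simpa [mem_T] using ht
  · rintro ⟨k, a⟩ ⟨l, b⟩ hne
    rw [adj_iff, ← cnt2 k l (b - a)]
    · have : ({i : ZMod 41 | (k, a) ∈ T i ∧ (l, b) ∈ T i} : Finset (ZMod 41)).card =
        (Finset.univ.filter fun t : ZMod 41 => B41 k t.val = true ∧ B41 l (t + (b - a)).val = true).card := by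
        refine Finset.card_bij (fun i _ => a - i) ?_ ?_ ?_
        · intro i hi
          simpa [mem_T] using hi
        · intro i _ j _ h
          exact sub_right_injective h
        · intro t ht
          refine ⟨a - t, ?_, by ring⟩
          have e : b - (a - t) = t + (b - a) := by ring
          simpa [mem_T, e] using ht
      rw [this]
    · by_contra! h
      exact hne (Prod.ext h.1 (sub_eq_zero.1 h.2).symm)
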